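/- Let (V, ℓ) be a weighted directed graph, let E = {(a,b) ∈ V × V : ℓ(a,b) < ∞} be its edge set, and let B ⊆ E (a piece). Let V(B) be the set of endpoints of edges of B, and let ∂B = {b ∈ V(B) : b is an endpoint of some edge in E ∖ B} be the boundary of B. Then for all u, v ∈ V(B): d(u, v) = min( d_B(u, v), inf_{b ∈ ∂B} ( d(u, b) + d(b, v) ) ). -/

import Mathlib

open scoped ENNReal

/-- The length of a walk `w₀, w₁, …, w_k`, given as a list of vertices, with respect
to the length function `ℓ : V → V → ℝ≥0∞`: the sum `Σ ℓ (w_{i-1}) (w_i)`. -/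
noncomputable def walkLen {V : Type*} (ℓ : V → V → ℝ≥0∞) : List V → ℝ≥0∞
  | [] => 0
  | [_] => 0
  | a :: b :: rest => ℓ a b + walkLen ℓ (b :: rest)

/-- `IsWalkIn F u v w` means the (nonempty) list of vertices `w` is a walk from `u`
to `v` all of whose consecutive pairs lie in `F`. -/
def IsWalkIn {V : Type*} (F : Set (V × V)) (u v : V) (w : List V) : Prop :=
  w.head? = some u ∧ w.getLast? = some v ∧ w.Chain' (fun a b => (a, b) ∈ F)

/-- `gdist ℓ F u v` is the infimum in `[0,∞]` of the lengths of all walks from `u`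
to `v` whose consecutive pairs lie in `F`. Taking `F = Set.univ` gives the distance
`d(u,v)` in the weighted directed graph `(V, ℓ)`. -/
noncomputable def gdist {V : Type*} (ℓ : V → V → ℝ≥0∞) (F : Set (V × V)) (u v : V) : ℝ≥0∞ :=
  ⨅ w ∈ {w : List V | IsWalkIn F u v w}, walkLen ℓ w

theorem gdist_le_walk {V : Type*} (ℓ : V → V → ℝ≥0∞) (F : Set (V × V)) {u v : V} {w : List V}
    (h : IsWalkIn F u v w) : gdist ℓ F u v ≤ walkLen ℓ w :=
  iInf₂_le (f := fun (w : List V) (_ : w ∈ {w : List V | IsWalkIn F u v w}) => walkLen ℓ w) w h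

theorem le_gdist_of {V : Type*} (ℓ : V → V → ℝ≥0∞) (F : Set (V × V)) {u v : V} {c : ℝ≥0∞}
    (h : ∀ w, IsWalkIn F u v w → c ≤ walkLen ℓ w) : c ≤ gdist ℓ F u v :=
  le_iInf₂ (fun w hw => h w hw)

theorem gdist_self_zero {V : Type*} (ℓ : V → V → ℝ≥0∞) (F : Set (V × V)) (u : V) :
    gdist ℓ F u u = 0 := by
  have h : IsWalkIn F u u [u] := ⟨rfl, rfl, List.isChain_singleton _⟩
  exact le_antisymm (gdist_le_walk ℓ F h) zero_le

theorem gdist_mono_set {V : Type*} (ℓ : V → V → ℝ≥0∞) {F G : Set (V × V)} (hFG : F ⊆ G)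
    (u v : V) : gdist ℓ G u v ≤ gdist ℓ F u v := by
  refine le_gdist_of ℓ F fun w hw => gdist_le_walk ℓ G ⟨hw.1, hw.2.1, ?_⟩
  exact List.IsChain.imp (fun a b h => hFG h) hw.2.2

theorem gdist_step {V : Type*} (ℓ : V → V → ℝ≥0∞) (F : Set (V × V)) {a b : V}
    (hab : (a, b) ∈ F) (v : V) : gdist ℓ F a v ≤ ℓ a b + gdist ℓ F b v := by
  unfold gdist
  rw [ENNReal.add_iInf]
  refine le_iInf fun w => ?_
  by_cases hw : IsWalkIn F b v w
  · obtain ⟨h1, h2, h3⟩ := hw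
    cases w with
    | nil => simp at h1
    | cons c rest =>
      obtain rfl : c = b := by simpa using h1
      have hw' : IsWalkIn F a v (a :: c :: rest) := by
        refine ⟨rfl, ?_, List.isChain_cons_cons.2 ⟨hab, h3⟩⟩
        simpa using h2
      have := gdist_le_walk ℓ F hw'
      have hc : IsWalkIn F c v (c :: rest) := ⟨h1, h2, h3⟩
      simpa [gdist, hc, walkLen] using this
  · simp [hw]

theorem gdist_walk_append {V : Type*} (ℓ : V → V → ℝ≥0∞) (F : Set (V × V)) (x v : V) :
    ∀ (w : List V) (u : V), IsWalkIn F u x w → gdist ℓ F u v ≤ walkLen ℓ w + gdist ℓ F x v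
  | [], u, h => by simp [IsWalkIn] at h
  | [a], u, h => by
      obtain ⟨h1, h2, -⟩ := h
      obtain rfl : a = u := by simpa using h1
      obtain rfl : a = x := by simpa using h2
      simp [walkLen]
  | a :: b :: rest, u, h => by
      obtain ⟨h1, h2, h3⟩ := h
      obtain rfl : a = u := by simpa using h1
      have h3' := List.isChain_cons_cons.1 h3
      have ih := gdist_walk_append ℓ F x v (b :: rest) b ⟨rfl, by simpa using h2, h3'.2⟩
      calc gdist ℓ F a v ≤ ℓ a b + gdist ℓ F b v := gdist_step ℓ F h3'.1 v
        _ ≤ ℓ a b + (walkLen ℓ (b :: rest) + gdist ℓ F x v) := by gcongr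
        _ = _ := by rw [walkLen, add_assoc]

theorem gdist_triangle {V : Type*} (ℓ : V → V → ℝ≥0∞) (F : Set (V × V)) (u x v : V) :
    gdist ℓ F u v ≤ gdist ℓ F u x + gdist ℓ F x v := by
  conv_rhs => unfold gdist
  rw [ENNReal.iInf_add]
  refine le_iInf fun w => ?_
  by_cases hw : IsWalkIn F u x w
  · simpa [hw, gdist] using gdist_walk_append ℓ F x v w u hw
  · simp [hw]

theorem walk_piece_cases {V : Type*} (ℓ : V → V → ℝ≥0∞) (B : Set (V × V)) (VB bd : Set V) (v : V)
    (hVB : ∀ a b, (a, b) ∈ B → b ∈ VB)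
    (hbd : ∀ a b, a ∈ VB → ℓ a b ≠ ⊤ → (a, b) ∉ B → a ∈ bd) :
    ∀ (w : List V) (u : V), u ∈ VB → IsWalkIn Set.univ u v w →
      gdist ℓ B u v ≤ walkLen ℓ w ∨
        ∃ b ∈ bd, gdist ℓ Set.univ u b + gdist ℓ Set.univ b v ≤ walkLen ℓ w
  | [], u, hu, h => by simp [IsWalkIn] at h
  | [a], u, hu, h => by
      obtain ⟨h1, h2, -⟩ := h
      obtain rfl : a = u := by simpa using h1
      obtain rfl : a = v := by simpa using h2
      left
      simp [gdist_self_zero]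
  | a :: b :: rest, u, hu, h => by
      have hw := gdist_le_walk ℓ _ h
      obtain ⟨h1, h2, h3⟩ := h
      obtain rfl : a = u := by simpa using h1
      have h3' := List.isChain_cons_cons.1 h3
      by_cases htop : ℓ a b = ⊤
      · left
        simp [walkLen, htop]
      by_cases hab : (a, b) ∈ B
      · rcases walk_piece_cases ℓ B VB bd v hVB hbd (b :: rest) b (hVB a b hab)
          ⟨rfl, by simpa using h2, h3'.2⟩ with ih | ⟨c, hc, ih⟩
        · left
          rw [walkLen]
          exact (gdist_step ℓ B hab v).trans (by gcongr)
        · right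
          refine ⟨c, hc, ?_⟩
          rw [walkLen]
          calc _ ≤ (ℓ a b + gdist ℓ Set.univ b c) + gdist ℓ Set.univ c v := by
                gcongr
                exact gdist_step ℓ Set.univ (Set.mem_univ _) c
            _ = ℓ a b + (gdist ℓ Set.univ b c + gdist ℓ Set.univ c v) := add_assoc _ _ _
            _ ≤ _ := by gcongr
      · right
        refine ⟨a, hbd a b hu htop hab, ?_⟩
        rw [gdist_self_zero, zero_add]
        exact hw

/-- Distances through a piece: if `B` is a piece (a subset of the edge set `E`),
`VB` is the set of endpoints of edges of `B`, and `bd` is its boundary (vertices of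
`VB` incident to an edge outside `B`), then for `u, v ∈ VB`,
`d(u,v) = min(d_B(u,v), inf_{b ∈ bd} (d(u,b) + d(b,v)))`. -/
theorem dist_eq_min_piece_boundary {V : Type*} [Fintype V]
    (ℓ : V → V → ℝ≥0∞) (E B : Set (V × V)) (VB bd : Set V) (u v : V)
    (hE : E = {e : V × V | ℓ e.1 e.2 < ⊤})
    (hB : B ⊆ E)
    (hVB : VB = {x : V | ∃ e ∈ B, e.1 = x ∨ e.2 = x})
    (hbd : bd = {x ∈ VB | ∃ e ∈ E \ B, e.1 = x ∨ e.2 = x})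
    (hu : u ∈ VB) (hv : v ∈ VB) :
    gdist ℓ Set.univ u v =
      min (gdist ℓ B u v)
        (⨅ b ∈ bd, (gdist ℓ Set.univ u b + gdist ℓ Set.univ b v)) := by
  refine le_antisymm (le_min (gdist_mono_set ℓ (Set.subset_univ _) u v)
    (le_iInf₂ fun b _ => gdist_triangle ℓ Set.univ u b v)) ?_
  refine le_gdist_of ℓ _ fun w hw => ?_
  have key := walk_piece_cases ℓ B VB bd v
    (by
      intro a b hab
      rw [hVB]
      exact ⟨(a, b), hab, Or.inr rfl⟩)
    (by
      intro a b ha ht hab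
      rw [hbd]
      refine ⟨ha, (a, b), ⟨?_, hab⟩, Or.inl rfl⟩
      rw [hE]
      exact lt_top_iff_ne_top.2 ht) w u hu hw
  rcases key with h | ⟨b, hb, h⟩
  · exact (min_le_left _ _).trans h
  · exact (min_le_right _ _).trans ((iInf₂_le b hb).trans h)
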